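/- arXiv:1101.1508 — 2 statements merged into one kernel-verified Lean document; each statement's English description precedes it below -/
import Mathlib

section
/- The affine group of K (the normalizer in Sym(K) of the translation group) acts on the set { C_f : f : K → K } of codes, and two functions f, g : K → K are EA-equivalent if and only if the codes C_f and C_g lie in the same orbit under this action, i.e., if and only if there exists an affine permutation π of K with π(C_f) = C_g. -/
/-- The code `C_f` associated to a function `f : K → K`. -/
def code {K : Type*} [Field K] [Algebra (ZMod 2) K] (f : K → K) : Set (K → ZMod 2) :=
  {c | ∃ (α β : K) (ε : ZMod 2),
    c = fun x => Algebra.trace (ZMod 2) K (α * x) + Algebra.trace (ZMod 2) K (β * f x) + ε}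

/-- An affine map `K → K`: a map of the form `x ↦ L(x) + t` with `L` an `F₂`-linear map
and `t ∈ K`. -/
def IsAffineMap {K : Type*} [Field K] [Algebra (ZMod 2) K] (A : K → K) : Prop :=
  ∃ (L : K →ₗ[ZMod 2] K) (t : K), ∀ x, A x = L x + t

/-- `f` and `g` are EA-equivalent: `g = A₁ ∘ f ∘ A₂ + A` with `A₁, A₂` affine
permutations and `A` an affine map. -/
def EAEquiv {K : Type*} [Field K] [Algebra (ZMod 2) K] (f g : K → K) : Prop :=
  ∃ A₁ A₂ A : K → K, IsAffineMap A₁ ∧ Function.Bijective A₁ ∧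
    IsAffineMap A₂ ∧ Function.Bijective A₂ ∧ IsAffineMap A ∧
    ∀ x, g x = A₁ (f (A₂ x)) + A x

/-- Two linear maps from a finite-dimensional space with the same range differ by an
automorphism of the source. -/
theorem LinearMap.exists_equiv_comp_eq_of_range_eq {F V W : Type*} [Field F]
    [AddCommGroup V] [Module F V] [FiniteDimensional F V] [AddCommGroup W] [Module F W]
    {φ ψ : V →ₗ[F] W} (h : LinearMap.range φ = LinearMap.range ψ) :
    ∃ e : V ≃ₗ[F] V, ∀ v, ψ v = φ (e v) := by
  have split (χ : V →ₗ[F] W) :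
      ∃ e : V ≃ₗ[F] LinearMap.range χ × LinearMap.ker χ, ∀ v, ((e v).1 : W) = χ v := by
    obtain ⟨p, hp⟩ := (LinearMap.ker χ).subtype.exists_leftInverse_of_injective
      (LinearMap.ker_eq_bot.mpr (LinearMap.ker χ).injective_subtype)
    have hp' (x : LinearMap.ker χ) : p x = x := LinearMap.congr_fun hp x
    refine ⟨χ.rangeRestrict.equivProdOfSurjectiveOfIsCompl p χ.range_rangeRestrict
      (LinearMap.range_eq_top.mpr fun x => ⟨x, hp' x⟩) ?_, fun v => rfl⟩
    rw [LinearMap.ker_rangeRestrict]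
    exact LinearMap.isCompl_of_proj hp'
  obtain ⟨e₁, he₁⟩ := split φ
  obtain ⟨e₂, he₂⟩ := split ψ
  have hker : Module.finrank F (LinearMap.ker ψ) = Module.finrank F (LinearMap.ker φ) := by
    have h₁ := φ.finrank_range_add_finrank_ker
    have h₂ := ψ.finrank_range_add_finrank_ker
    rw [h] at h₁
    omega
  refine ⟨e₂.trans (((LinearEquiv.ofEq _ _ h.symm).prodCongr
    (LinearEquiv.ofFinrankEq _ _ hker)).trans e₁.symm), fun v => ?_⟩
  rw [← he₁, ← he₂]
  simp

section Codes

variable {K : Type*} [Field K] [Algebra (ZMod 2) K]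

theorem isAffineMap_iff {A : K → K} :
    IsAffineMap A ↔ ∀ x y, A (x + y) + A 0 = A x + A y := by
  constructor
  · rintro ⟨L, t, h⟩ x y
    simp only [h, map_add, map_zero]
    ring
  · intro h
    let L : K →+ K := AddMonoidHom.mk' (fun x => A x - A 0) fun x y => by
      linear_combination h x y
    exact ⟨L.toZModLinearMap 2, A 0, fun x => (sub_add_cancel _ _).symm⟩

theorem IsAffineMap.map_add {A : K → K} (hA : IsAffineMap A) (x y : K) :
    A (x + y) + A 0 = A x + A y :=
  isAffineMap_iff.mp hA x y

theorem IsAffineMap.rightInverse {A B : K → K} (hA : IsAffineMap A)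
    (hinj : Function.Injective A) (hB : Function.RightInverse B A) : IsAffineMap B := by
  obtain ⟨L, t, h⟩ := hA
  refine isAffineMap_iff.mpr fun x y => ?_
  have hLB (z : K) : L (B z) = z - t := by rw [eq_sub_iff_add_eq, ← h, hB]
  apply hinj
  simp only [h, _root_.map_add, hLB]
  ring

variable (K) in
/-- The affine functions `K → F₂`. -/
def affineFunctions : Submodule (ZMod 2) (K → ZMod 2) where
  carrier := {c | ∀ x y, c (x + y) + c 0 = c x + c y}
  zero_mem' := by simp
  add_mem' := by
    intro a b ha hb x y
    simp only [Pi.add_apply]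
    linear_combination ha x y + hb x y
  smul_mem' := by
    intro r a ha x y
    simp only [Pi.smul_apply, smul_eq_mul]
    linear_combination r * ha x y

theorem comp_mem_affineFunctions {c : K → ZMod 2} (hc : c ∈ affineFunctions K) {A : K → K}
    (hA : IsAffineMap A) : c ∘ A ∈ affineFunctions K := by
  intro x y
  have h₁ := hc (A (x + y)) (A 0)
  have h₂ := hc (A x) (A y)
  rw [hA.map_add] at h₁
  simp only [Function.comp_apply]
  rw [← h₁, h₂]

/-- The component functions `x ↦ Tr(β f(x))` of `f`, as a linear map in `β`. -/
noncomputable def component (f : K → K) : K →ₗ[ZMod 2] (K → ZMod 2) :=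
  LinearMap.pi fun x => (Algebra.traceForm (ZMod 2) K).flip (f x)

theorem component_apply (f : K → K) (β x : K) :
    component f β x = Algebra.trace (ZMod 2) K (β * f x) :=
  rfl

theorem component_mem_affineFunctions {A : K → K} (hA : IsAffineMap A) (β : K) :
    component A β ∈ affineFunctions K := by
  intro x y
  simp only [component_apply, ← _root_.map_add, ← mul_add, hA.map_add]

/-- The component functions of `f` modulo affine functions. -/
noncomputable def componentClass (f : K → K) :
    K →ₗ[ZMod 2] (K → ZMod 2) ⧸ affineFunctions K :=
  (affineFunctions K).mkQ ∘ₗ component f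

theorem componentClass_eq_iff {f g : K → K} {β γ : K} :
    componentClass f β = componentClass g γ ↔
      component f β - component g γ ∈ affineFunctions K :=
  Submodule.Quotient.eq _

section Finite

variable [Finite K]

theorem exists_eq_trace_mul (l : Module.Dual (ZMod 2) K) :
    ∃ α : K, ∀ x, l x = Algebra.trace (ZMod 2) K (α * x) := by
  have hT := traceForm_nondegenerate (ZMod 2) K
  obtain ⟨α, rfl⟩ := ((Algebra.traceForm (ZMod 2) K).toDual hT).surjective l
  exact ⟨α, fun x => rfl⟩

theorem exists_trace_adjoint (e : K ≃ₗ[ZMod 2] K) :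
    ∃ e' : K ≃ₗ[ZMod 2] K, ∀ x y,
      Algebra.trace (ZMod 2) K (x * e y) = Algebra.trace (ZMod 2) K (e' x * y) := by
  have hT := traceForm_nondegenerate (ZMod 2) K
  let d := (Algebra.traceForm (ZMod 2) K).toDual hT
  refine ⟨(d.trans e.dualMap).trans d.symm, fun x y => ?_⟩
  have h : d (((d.trans e.dualMap).trans d.symm) x) y = d x (e y) := by simp
  exact h.symm

theorem eq_of_trace_mul_eq {x y : K}
    (h : ∀ β : K, Algebra.trace (ZMod 2) K (β * x) = Algebra.trace (ZMod 2) K (β * y)) :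
    x = y := by
  have hT := traceForm_nondegenerate (ZMod 2) K
  apply ((Algebra.traceForm (ZMod 2) K).toDual hT).injective
  ext β
  simpa [LinearMap.BilinForm.toDual_def, Algebra.traceForm_apply, mul_comm] using h β

theorem isAffineMap_of_component {A : K → K}
    (h : ∀ β, component A β ∈ affineFunctions K) : IsAffineMap A := by
  refine isAffineMap_iff.mpr fun x y => eq_of_trace_mul_eq fun β => ?_
  simpa only [component_apply, ← _root_.map_add, ← mul_add] using h β x y

theorem mem_affineFunctions_iff {c : K → ZMod 2} :
    c ∈ affineFunctions K ↔
      ∃ (α : K) (ε : ZMod 2), ∀ x, c x = Algebra.trace (ZMod 2) K (α * x) + ε := by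
  constructor
  · intro h
    let l : K →+ ZMod 2 := AddMonoidHom.mk' (fun x => c x - c 0) fun x y => by
      linear_combination h x y
    obtain ⟨α, hα⟩ := exists_eq_trace_mul (l.toZModLinearMap 2)
    exact ⟨α, c 0, fun x => by rw [← hα]; exact (sub_add_cancel _ _).symm⟩
  · rintro ⟨α, ε, h⟩ x y
    simp only [h, mul_add, _root_.map_add, mul_zero, map_zero]
    ring

theorem mem_code_iff {f : K → K} {c : K → ZMod 2} :
    c ∈ code f ↔ ∃ β, c - component f β ∈ affineFunctions K := by
  simp only [code, Set.mem_ofPred_eq, mem_affineFunctions_iff, funext_iff, Pi.sub_apply,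
    component_apply]
  constructor
  · rintro ⟨α, β, ε, h⟩
    exact ⟨β, α, ε, fun x => by rw [h]; ring⟩
  · rintro ⟨β, α, ε, h⟩
    exact ⟨α, β, ε, fun x => by linear_combination h x⟩

theorem code_eq_preimage (f : K → K) :
    code f = (affineFunctions K).mkQ ⁻¹' LinearMap.range (componentClass f) := by
  ext c
  rw [mem_code_iff, Set.mem_preimage, SetLike.mem_coe, LinearMap.mem_range]
  refine exists_congr fun β => ?_
  rw [eq_comm]
  exact (Submodule.Quotient.eq _).symm

theorem code_eq_iff {f g : K → K} :
    code f = code g ↔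
      LinearMap.range (componentClass f) = LinearMap.range (componentClass g) := by
  rw [code_eq_preimage, code_eq_preimage,
    (Submodule.mkQ_surjective _).preimage_injective.eq_iff, SetLike.coe_set_eq]

theorem image_code {π : K → K} (hπ : IsAffineMap π) (hbij : Function.Bijective π)
    (f : K → K) : (fun c : K → ZMod 2 => c ∘ π) '' code f = code (f ∘ π) := by
  ext c
  constructor
  · rintro ⟨c, hc, rfl⟩
    obtain ⟨β, h⟩ := mem_code_iff.mp hc
    exact mem_code_iff.mpr ⟨β, comp_mem_affineFunctions h hπ⟩
  · intro hc
    obtain ⟨β, h⟩ := mem_code_iff.mp hc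
    obtain ⟨ρ, hl, hr⟩ := Function.bijective_iff_has_inverse.mp hbij
    refine ⟨c ∘ ρ, mem_code_iff.mpr ⟨β, ?_⟩, ?_⟩
    · convert comp_mem_affineFunctions h (hπ.rightInverse hbij.1 hr) using 1
      ext x
      simp [component_apply, hr x]
    · ext x
      simp [hl x]

theorem code_eq_iff_exists {f g : K → K} :
    code f = code g ↔
      ∃ B A : K → K, IsAffineMap B ∧ Function.Bijective B ∧ IsAffineMap A ∧
        ∀ x, g x = B (f x) + A x := by
  rw [code_eq_iff]
  constructor
  · intro h
    obtain ⟨e, he⟩ := LinearMap.exists_equiv_comp_eq_of_range_eq h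
    obtain ⟨e', he'⟩ := exists_trace_adjoint e
    refine ⟨e', fun x => g x - e' (f x), ⟨e', 0, fun x => by simp⟩, e'.bijective,
      isAffineMap_of_component fun β => ?_, fun x => by ring⟩
    convert componentClass_eq_iff.mp (he β) using 1
    ext x
    simp only [component_apply, mul_sub, map_sub, Pi.sub_apply]
    rw [mul_comm β (e' (f x)), ← he', mul_comm (f x)]
  · rintro ⟨B, A, ⟨L, t, hB⟩, hbij, hA, h⟩
    have hL : Function.Bijective L := by
      have : (L : K → K) = Equiv.subRight t ∘ B := by
        ext x
        simp [hB]
      rw [this]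
      exact (Equiv.bijective _).comp hbij
    obtain ⟨e, he⟩ := exists_trace_adjoint (LinearEquiv.ofBijective L hL)
    have hclass : componentClass g = componentClass f ∘ₗ e.toLinearMap := by
      ext1 β
      refine componentClass_eq_iff.mpr ?_
      have hA' : IsAffineMap fun x => A x + t :=
        isAffineMap_iff.mpr fun x y => by linear_combination hA.map_add x y
      convert component_mem_affineFunctions hA' β using 1
      ext x
      have hx : Algebra.trace (ZMod 2) K (β * L (f x)) =
          Algebra.trace (ZMod 2) K (e β * f x) := he β (f x)
      simp only [component_apply, Pi.sub_apply, LinearEquiv.coe_coe, h, hB, mul_add,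
        _root_.map_add, hx]
      ring
    rw [hclass, LinearMap.range_comp_of_range_eq_top _ e.range]

end Finite

end Codes

/-- The affine group of `K` acts on the set `{C_f : f : K → K}` of codes, and `f, g` are
EA-equivalent if and only if `C_f` and `C_g` lie in the same orbit, i.e. iff
`π(C_f) = C_g` for some affine permutation `π` of `K`. -/
theorem stmt4 {K : Type*} [Field K] [Fintype K] [Algebra (ZMod 2) K]
    (n : ℕ) (hn : 1 ≤ n) (hcard : Fintype.card K = 2 ^ n) :
    (∀ π : K → K, IsAffineMap π → Function.Bijective π →
      ∀ f : K → K, ∃ g : K → K, (fun c : K → ZMod 2 => c ∘ π) '' code f = code g) ∧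
    (∀ f g : K → K, EAEquiv f g ↔
      ∃ π : K → K, IsAffineMap π ∧ Function.Bijective π ∧
        (fun c : K → ZMod 2 => c ∘ π) '' code f = code g) := by
  refine ⟨fun π hπ hbij f => ⟨f ∘ π, image_code hπ hbij f⟩, fun f g => ⟨?_, ?_⟩⟩
  · rintro ⟨B, π, A, hB, hBbij, hπ, hπbij, hA, h⟩
    exact ⟨π, hπ, hπbij, (image_code hπ hπbij f).trans
      (code_eq_iff_exists.mpr ⟨B, A, hB, hBbij, hA, h⟩)⟩
  · rintro ⟨π, hπ, hπbij, h⟩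
    rw [image_code hπ hπbij] at h
    obtain ⟨B, A, hB, hBbij, hA, h⟩ := code_eq_iff_exists.mp h
    exact ⟨B, π, A, hB, hBbij, hπ, hπbij, hA, h⟩
end

section
/- For every z ∈ L^*, the multiplication map x ↦ z x is an automorphism of the code C_{f_{c,s}}; this follows from the identity f_{c,s}(z x) = z^{2^s+1} · f_{c z^{1−2^s}, s}(x) valid for all x ∈ K, together with the fact that the code C_{f_{c,s}} is independent of the choice of the parameter in K ∖ L. -/
/-- The trinomial family `f_{c,s}(x) = b x^(2^s+1) + (b x^(2^s+1))^(2^k) + c x^(2^k+1)`. -/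
def fam {K : Type*} [Field K] (k s : ℕ) (b c : K) : K → K :=
  fun x => b * x ^ (2 ^ s + 1) + (b * x ^ (2 ^ s + 1)) ^ (2 ^ k) + c * x ^ (2 ^ k + 1)

/-- Multiplying a function by a nonzero scalar does not change its code. -/
theorem code_const_mul {K : Type*} [Field K] [Algebra (ZMod 2) K] (f : K → K) {a : K}
    (ha : a ≠ 0) : code (fun x => a * f x) = code f := by
  ext w
  constructor
  · rintro ⟨α, β, ε, rfl⟩
    exact ⟨α, β * a, ε, by simp only [mul_assoc]⟩
  · rintro ⟨α, β, ε, rfl⟩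
    refine ⟨α, β * a⁻¹, ε, ?_⟩
    funext x
    rw [mul_assoc β, inv_mul_cancel_left₀ ha]

/-- Precomposing with multiplication by a nonzero scalar maps the code of `f` onto the code of
the precomposed function. -/
theorem image_comp_mul_code {K : Type*} [Field K] [Algebra (ZMod 2) K] (f : K → K) {z : K}
    (hz : z ≠ 0) :
    (fun w : K → ZMod 2 => w ∘ fun x => z * x) '' code f = code (fun x => f (z * x)) := by
  ext w
  constructor
  · rintro ⟨_, ⟨α, β, ε, rfl⟩, rfl⟩
    exact ⟨α * z, β, ε, by funext x; simp only [Function.comp_apply, mul_assoc]⟩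
  · rintro ⟨α, β, ε, rfl⟩
    refine ⟨_, ⟨α * z⁻¹, β, ε, rfl⟩, ?_⟩
    funext x
    simp only [Function.comp_apply]
    rw [mul_assoc α, inv_mul_cancel_left₀ hz]

/-- The absolute trace is invariant under powers of the Frobenius. -/
theorem trace_pow_two_pow {K : Type*} [Field K] [Fintype K] [Algebra (ZMod 2) K] (k : ℕ) (y : K) :
    Algebra.trace (ZMod 2) K (y ^ 2 ^ k) = Algebra.trace (ZMod 2) K y := by
  induction k with
  | zero => simp
  | succ k ih =>
    rw [pow_succ, pow_mul, ← ih]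
    have h := Algebra.trace_eq_of_algEquiv
      (FiniteField.frobeniusAlgEquivOfAlgebraic (ZMod 2) K) (y ^ 2 ^ k)
    simpa using h

/-- If some element is not fixed by the involution `x ↦ x ^ 2 ^ k`, then elements of the fixed
field have absolute trace zero. -/
theorem trace_eq_zero_of_pow_eq {K : Type*} [Field K] [Fintype K] [Algebra (ZMod 2) K] {k : ℕ}
    {c y : K} (hc : c ^ 2 ^ k ≠ c) (hy : y ^ 2 ^ k = y)
    (hinv : ∀ x : K, (x ^ 2 ^ k) ^ 2 ^ k = x) : Algebra.trace (ZMod 2) K y = 0 := by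
  have : CharP K 2 := charP_of_injective_algebraMap (algebraMap (ZMod 2) K).injective 2
  have hD : c + c ^ 2 ^ k ≠ 0 := fun h => hc (CharTwo.add_eq_zero.mp h).symm
  have hDq : (c + c ^ 2 ^ k) ^ 2 ^ k = c + c ^ 2 ^ k := by
    rw [add_pow_char_pow, hinv, add_comm]
  have hsum : y = c * y / (c + c ^ 2 ^ k) + (c * y / (c + c ^ 2 ^ k)) ^ 2 ^ k := by
    rw [div_pow, mul_pow, hDq, hy]
    field_simp
  rw [hsum, map_add, trace_pow_two_pow, CharTwo.add_self_eq_zero]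

/-- The code of `fam k s b c` does not depend on the parameter `c` outside the fixed field. -/
theorem code_fam_subset {K : Type*} [Field K] [Fintype K] [Algebra (ZMod 2) K] {k : ℕ} (s : ℕ)
    (b : K) {c d : K} (hd : d ^ 2 ^ k ≠ d)
    (hinv : ∀ x : K, (x ^ 2 ^ k) ^ 2 ^ k = x) : code (fam k s b c) ⊆ code (fam k s b d) := by
  have : CharP K 2 := charP_of_injective_algebraMap (algebraMap (ZMod 2) K).injective 2
  rintro _ ⟨α, β, ε, rfl⟩
  have hD : d + d ^ 2 ^ k ≠ 0 := fun h => hd (CharTwo.add_eq_zero.mp h).symm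
  have hDq : (d + d ^ 2 ^ k) ^ 2 ^ k = d + d ^ 2 ^ k := by
    rw [add_pow_char_pow, hinv, add_comm]
  have h2 : (2 : K) = 0 := CharTwo.two_eq_zero
  obtain ⟨γ, hγ⟩ : ∃ γ, γ = (β * c + (β * c) ^ 2 ^ k + (β + β ^ 2 ^ k) * d ^ 2 ^ k)
      / (d + d ^ 2 ^ k) := ⟨_, rfl⟩
  have hγq : γ ^ 2 ^ k = (β * c + (β * c) ^ 2 ^ k + (β + β ^ 2 ^ k) * d) / (d + d ^ 2 ^ k) := by
    rw [hγ, div_pow, hDq, add_pow_char_pow, add_pow_char_pow, mul_pow (β + β ^ 2 ^ k),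
      add_pow_char_pow, hinv, hinv, hinv]
    ring
  have h₁ : (β + γ) ^ 2 ^ k = β + γ := by
    rw [add_pow_char_pow, hγq, hγ]
    field_simp
    linear_combination (d * β ^ 2 ^ k - d ^ 2 ^ k * β) * h2
  have h₂ : (β * c + γ * d) ^ 2 ^ k = β * c + γ * d := by
    rw [add_pow_char_pow, mul_pow γ, hγq, hγ]
    field_simp
    linear_combination (β ^ 2 ^ k * c ^ 2 ^ k * d ^ 2 ^ k - β * c * d) * h2
  refine ⟨α, γ, ε, ?_⟩
  funext x
  congr 2
  rw [← CharTwo.add_eq_zero, ← map_add]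
  refine trace_eq_zero_of_pow_eq hd ?_ hinv
  have hu : (b * x ^ (2 ^ s + 1) + (b * x ^ (2 ^ s + 1)) ^ 2 ^ k) ^ 2 ^ k
      = b * x ^ (2 ^ s + 1) + (b * x ^ (2 ^ s + 1)) ^ 2 ^ k := by
    rw [add_pow_char_pow, hinv, add_comm]
  have hn : (x ^ (2 ^ k + 1)) ^ 2 ^ k = x ^ (2 ^ k + 1) := by
    rw [pow_succ, mul_pow, hinv, mul_comm]
  have hsplit : β * fam k s b c x + γ * fam k s b d x
      = (β + γ) * (b * x ^ (2 ^ s + 1) + (b * x ^ (2 ^ s + 1)) ^ 2 ^ k)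
        + (β * c + γ * d) * x ^ (2 ^ k + 1) := by
    unfold fam
    ring
  rw [hsplit, add_pow_char_pow, mul_pow (β + γ), mul_pow (β * c + γ * d), h₁, h₂, hu, hn]

/-- For every `z ∈ L^*` (i.e. `z^(2^k) = z`, `z ≠ 0`), the identity
`f_{c,s}(z x) = z^(2^s+1) · f_{c z^(1-2^s), s}(x)` holds for all `x ∈ K`, and the
multiplication map `x ↦ z x` is an automorphism of the code `C_{f_{c,s}}`. -/
theorem stmt12 {K : Type*} [Field K] [Fintype K] [Algebra (ZMod 2) K]
    (k s : ℕ) (hk : Odd k) (hs : Odd s) (hks : Nat.Coprime k s)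
    (hcard : Fintype.card K = 2 ^ (2 * k))
    (b : K) (hb : ∀ x : K, x ≠ 0 → ∃ m : ℕ, x = b ^ m)
    (c : K) (hc : c ^ (2 ^ k) ≠ c)
    (z : K) (hzL : z ^ (2 ^ k) = z) (hz0 : z ≠ 0) :
    (∀ x, fam k s b c (z * x)
        = z ^ (2 ^ s + 1) * fam k s b (c * z * (z ^ (2 ^ s))⁻¹) x) ∧
    (fun w : K → ZMod 2 => w ∘ fun x => z * x) '' code (fam k s b c)
      = code (fam k s b c) := by
  have hzs : (z ^ (2 ^ s)) ^ 2 ^ k = z ^ (2 ^ s) := by rw [pow_right_comm, hzL]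
  have hinv : ∀ x : K, (x ^ 2 ^ k) ^ 2 ^ k = x := fun x => by
    rw [← pow_mul, ← pow_add, ← two_mul, ← hcard, FiniteField.pow_card]
  have hscale : ∀ x, fam k s b c (z * x)
      = z ^ (2 ^ s + 1) * fam k s b (c * z * (z ^ (2 ^ s))⁻¹) x := by
    intro x
    have hzq : (z ^ (2 ^ s + 1)) ^ 2 ^ k = z ^ (2 ^ s + 1) := by
      rw [pow_succ, mul_pow, hzs, hzL]
    have h₁ : (b * (z * x) ^ (2 ^ s + 1)) ^ 2 ^ k
        = z ^ (2 ^ s + 1) * (b * x ^ (2 ^ s + 1)) ^ 2 ^ k := by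
      rw [mul_pow z, mul_left_comm, mul_pow (z ^ (2 ^ s + 1)), hzq]
    have h₂ : c * (z * x) ^ (2 ^ k + 1)
        = z ^ (2 ^ s + 1) * (c * z * (z ^ (2 ^ s))⁻¹ * x ^ (2 ^ k + 1)) := by
      rw [mul_pow z, pow_succ z (2 ^ k), hzL, pow_succ z (2 ^ s)]
      field_simp
    unfold fam
    rw [h₁, h₂, mul_pow z]
    ring
  refine ⟨hscale, ?_⟩
  have hd : (c * z * (z ^ (2 ^ s))⁻¹) ^ 2 ^ k ≠ c * z * (z ^ (2 ^ s))⁻¹ := by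
    rw [mul_pow, mul_pow, inv_pow, hzs, hzL]
    intro h
    exact hc (mul_right_cancel₀ hz0 (mul_right_cancel₀ (inv_ne_zero (pow_ne_zero _ hz0)) h))
  rw [image_comp_mul_code _ hz0, funext hscale, code_const_mul _ (pow_ne_zero _ hz0)]
  exact (code_fam_subset s b hc hinv).antisymm (code_fam_subset s b hd hinv)
end
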